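/- arXiv:2004.06530 — 2 statements merged into one kernel-verified Lean document; each statement's English description precedes it below -/
import Mathlib

section
/- Let f be a failing pipeline instance (Fail f) and let g₁, …, g_k be succeeding instances (not Fail g_i for each i) that are pairwise disjoint and each disjoint from f. Suppose the set of all minimal definitive root causes (where two candidates (S, c) and (S', c') are identified when S = S' and c p = c' p for all p ∈ S) has at most k elements. Then the output candidate (D₁ ∪ ⋯ ∪ D_k, f) of the Stacked Shortcut algorithm on f and g₁, …, g_k is not a truncated assertion. -/
open scoped Classical

/-- One step of the Shortcut algorithm: try replacing the value of `cur` at `p`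
by `g p`; keep the replacement exactly when the result fails. -/
noncomputable def shortcutStep {P : Type*} [DecidableEq P] {V : P → Type*}
    (Fail : ((p : P) → V p) → Prop) (g : (p : P) → V p)
    (cur : (p : P) → V p) (p : P) : (p : P) → V p :=
  if Fail (Function.update cur p (g p)) then Function.update cur p (g p) else cur

/-- The final instance of the Shortcut run on `f` and `g`, processing the
parameters in the order given by the list `l`. -/
noncomputable def shortcutFinal {P : Type*} [DecidableEq P] {V : P → Type*}
    (Fail : ((p : P) → V p) → Prop) (f g : (p : P) → V p) (l : List P) :
    (p : P) → V p :=
  l.foldl (shortcutStep Fail g) f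

/-- The parameter set of the asserted root cause: parameters where the final
instance agrees with `f`. -/
def assertedSet {P : Type*} {V : P → Type*}
    (finalInst f : (p : P) → V p) : Set P :=
  {p : P | finalInst p = f p}

/-- An instance `x` satisfies the candidate `(S, c)` if it agrees with `c` on `S`. -/
def Satisfies {P : Type*} {V : P → Type*}
    (x : (p : P) → V p) (S : Set P) (c : (p : P) → V p) : Prop :=
  ∀ p ∈ S, x p = c p

/-- `(S, c)` is a definitive root cause: some failing instance satisfies it and
every instance satisfying it fails. -/
def DefinitiveRootCause {P : Type*} {V : P → Type*}
    (Fail : ((p : P) → V p) → Prop) (S : Set P) (c : (p : P) → V p) : Prop :=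
  (∃ x, Fail x ∧ Satisfies x S c) ∧ (∀ x, Satisfies x S c → Fail x)

/-- `(S, c)` is a minimal definitive root cause. -/
def MinimalDRC {P : Type*} {V : P → Type*}
    (Fail : ((p : P) → V p) → Prop) (S : Set P) (c : (p : P) → V p) : Prop :=
  DefinitiveRootCause Fail S c ∧ ∀ S' ⊂ S, ¬ DefinitiveRootCause Fail S' c

theorem aux_fail {P : Type*} [DecidableEq P] {V : P → Type*}
    (Fail : ((p : P) → V p) → Prop) (g : (p : P) → V p) (l : List P) :
    ∀ f : (p : P) → V p, Fail f → Fail (shortcutFinal Fail f g l) := by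
  induction l with
  | nil => intro f hf; exact hf
  | cons a l ih =>
    intro f hf
    refine ih (shortcutStep Fail g f a) ?_
    unfold shortcutStep
    split_ifs with h
    · exact h
    · exact hf

theorem aux_vals {P : Type*} [DecidableEq P] {V : P → Type*}
    (Fail : ((p : P) → V p) → Prop) (g : (p : P) → V p) (l : List P) :
    ∀ (f : (p : P) → V p) (p : P),
      shortcutFinal Fail f g l p = f p ∨ shortcutFinal Fail f g l p = g p := by
  induction l with
  | nil => intro f p; exact Or.inl rfl
  | cons a l ih =>
    intro f p
    have h1 : shortcutStep Fail g f a p = f p ∨ shortcutStep Fail g f a p = g p := by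
      unfold shortcutStep
      split_ifs with h
      · by_cases hp : p = a
        · subst hp; right; simp
        · left; simp [hp]
      · exact Or.inl rfl
    rcases ih (shortcutStep Fail g f a) p with h | h
    · rcases h1 with h1 | h1
      · exact Or.inl (h.trans h1)
      · exact Or.inr (h.trans h1)
    · exact Or.inr h

theorem aux_min {P : Type*} [Fintype P] {V : P → Type*}
    (Fail : ((p : P) → V p) → Prop) (x : (p : P) → V p) (hx : Fail x) :
    ∃ T : Set P, MinimalDRC Fail T x := by
  have hne : DefinitiveRootCause Fail Set.univ x := by
    refine ⟨⟨x, hx, fun p _ => rfl⟩, fun y hy => ?_⟩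
    have : y = x := funext fun p => hy p trivial
    exact this ▸ hx
  obtain ⟨T, hT, hmin⟩ := WellFounded.has_min (wellFounded_lt (α := Set P))
    {T | DefinitiveRootCause Fail T x} ⟨_, hne⟩
  exact ⟨T, hT, fun S' hS' h => hmin S' h hS'⟩

/-- If the successful instances `g 1, …, g k` are mutually
disjoint and disjoint from the failing instance `f`, and there are at most `k`
distinct minimal definitive root causes (identified when they have the same
parameter set and agree on it), then the Stacked Shortcut output
`(D₁ ∪ ⋯ ∪ D_k, f)` is not a truncated assertion. -/
theorem stacked_shortcut_no_truncation
    {P : Type*} [Fintype P] [DecidableEq P] {V : P → Type*}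
    (Fail : ((p : P) → V p) → Prop)
    (f : (p : P) → V p) (k : ℕ) (g : Fin k → (p : P) → V p)
    (hf : Fail f) (hg : ∀ i, ¬ Fail (g i))
    (hpair : ∀ i j, i ≠ j → ∀ p : P, g i p ≠ g j p)
    (hdisjf : ∀ i, ∀ p : P, f p ≠ g i p)
    (ls : Fin k → List P)
    (hnodup : ∀ i, (ls i).Nodup) (hfull : ∀ i, ∀ p : P, p ∈ ls i)
    (hatmostk : ∃ reps : Fin k → Set P × ((p : P) → V p),
      ∀ (S : Set P) (c : (p : P) → V p), MinimalDRC Fail S c →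
        ∃ i, S = (reps i).1 ∧ ∀ p ∈ S, c p = (reps i).2 p) :
    ¬ ∃ (S : Set P) (c : (p : P) → V p),
        MinimalDRC Fail S c ∧
        (⋃ i, assertedSet (shortcutFinal Fail f (g i) (ls i)) f) ⊆ S ∧
        (∀ p ∈ ⋃ i, assertedSet (shortcutFinal Fail f (g i) (ls i)) f, f p = c p) ∧
        (⋃ i, assertedSet (shortcutFinal Fail f (g i) (ls i)) f) ≠ S := by
  rintro ⟨S, c, hS, hsub, hfc, hne⟩
  obtain ⟨reps, hreps⟩ := hatmostk
  let y : Option (Fin k) → (p : P) → V p := fun o =>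
    match o with
    | none => f
    | some i => shortcutFinal Fail f (g i) (ls i)
  have hy : ∀ o, Fail (y o) := by
    intro o
    cases o with
    | none => exact hf
    | some i => exact aux_fail Fail (g i) (ls i) f hf
  choose T hT using fun o => aux_min Fail (y o) (hy o)
  choose r hr1 hr2 using fun o => hreps (T o) (y o) (hT o)
  -- no `T (some i)` lies inside the asserted set
  have key : ∀ i, ¬ ∀ p ∈ T (some i), y (some i) p = f p := by
    intro i hi
    have hD : T (some i) ⊆ ⋃ i, assertedSet (shortcutFinal Fail f (g i) (ls i)) f :=
      fun p hp => Set.mem_iUnion.2 ⟨i, hi p hp⟩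
    have hss : T (some i) ⊂ S :=
      lt_of_le_of_lt hD (lt_of_le_of_ne hsub hne)
    have heq : ∀ p ∈ T (some i), y (some i) p = c p :=
      fun p hp => (hi p hp).trans (hfc p (hD hp))
    refine hS.2 _ hss ⟨⟨y (some i), hy (some i), heq⟩, fun x hx => ?_⟩
    exact (hT (some i)).1.2 x fun p hp => (hx p hp).trans (heq p hp).symm
  obtain ⟨a, b, hab, hrab⟩ : ∃ a b, a ≠ b ∧ r a = r b :=
    Fintype.exists_ne_map_eq_of_card_lt r (by simp)
  have hTT : T a = T b := by rw [hr1 a, hr1 b, hrab]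
  have hyy : ∀ p ∈ T a, y a p = y b p := by
    intro p hp
    rw [hr2 a p hp, hr2 b p (hTT ▸ hp), hrab]
  cases a with
  | none =>
    cases b with
    | none => exact hab rfl
    | some j => exact key j fun p hp => (hyy p (hTT ▸ hp)).symm
  | some i =>
    cases b with
    | none => exact key i fun p hp => hyy p hp
    | some j =>
      refine key i fun p hp => ?_
      have hij : i ≠ j := fun h => hab (congrArg some h)
      have h := hyy p hp
      rcases aux_vals Fail (g i) (ls i) f p with h1 | h1
      · exact h1
      · rcases aux_vals Fail (g j) (ls j) f p with h2 | h2
        · exact h.trans h2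
        · exact absurd (h1.symm.trans (h.trans h2)) (hpair i j hij p)
end

section
/- Let f and g be pipeline instances with Fail f and with f and g disjoint, and let (D, f) be the asserted root cause of the Shortcut run on f and g with some list enumerating every parameter of P exactly once. Then for every parameter p ∈ D there exists a succeeding instance x (not Fail x) such that x p = g p, x q = f q for every q ∈ D with q ≠ p, and x q = f q or x q = g q for every parameter q. -/
open scoped Classical

theorem foldl_keep {P : Type*} [DecidableEq P] {V : P → Type*}
    (Fail : ((p : P) → V p) → Prop) (g : (p : P) → V p) (q : P) (l : List P) :
    ∀ c : (p : P) → V p, c q = g q → l.foldl (shortcutStep Fail g) c q = g q := by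
  induction l with
  | nil => intro c h; exact h
  | cons a l ih =>
    intro c h
    apply ih
    unfold shortcutStep
    split_ifs
    · by_cases e : q = a
      · subst e; simp
      · simp [Function.update_of_ne e, h]
    · exact h

theorem foldl_fg {P : Type*} [DecidableEq P] {V : P → Type*}
    (Fail : ((p : P) → V p) → Prop) (f g : (p : P) → V p) (q : P) (l : List P) :
    ∀ c : (p : P) → V p, (c q = f q ∨ c q = g q) →
      (l.foldl (shortcutStep Fail g) c q = f q ∨ l.foldl (shortcutStep Fail g) c q = g q) := by
  induction l with
  | nil => intro c h; exact h
  | cons a l ih =>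
    intro c h
    apply ih
    unfold shortcutStep
    split_ifs
    · by_cases e : q = a
      · subst e; simp
      · simpa [Function.update_of_ne e] using h
    · exact h

/-- For each parameter `p` of the asserted set `D` of a Shortcut
run (under the Disjointness Condition and `Fail f`), there is a succeeding
instance agreeing with `g` at `p`, with `f` on the rest of `D`, and drawing all
of its values from `f` or `g`. -/
theorem shortcut_asserted_parameters_witness
    {P : Type*} [Fintype P] [DecidableEq P] {V : P → Type*}
    (Fail : ((p : P) → V p) → Prop)
    (f g : (p : P) → V p)
    (hf : Fail f)
    (hdisj : ∀ p : P, f p ≠ g p)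
    (l : List P) (hnodup : l.Nodup) (hfull : ∀ p : P, p ∈ l) :
    ∀ p ∈ assertedSet (shortcutFinal Fail f g l) f,
      ∃ x : (p : P) → V p, ¬ Fail x ∧ x p = g p ∧
        (∀ q ∈ assertedSet (shortcutFinal Fail f g l) f, q ≠ p → x q = f q) ∧
        (∀ q : P, x q = f q ∨ x q = g q) := by
  intro p hp
  obtain ⟨a, b, rfl⟩ := List.append_of_mem (hfull p)
  have hfin : shortcutFinal Fail f g (a ++ p :: b) =
      b.foldl (shortcutStep Fail g)
        (shortcutStep Fail g (a.foldl (shortcutStep Fail g) f) p) := by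
    simp [shortcutFinal]
  have hfg := fun q => foldl_fg Fail f g q a f (Or.inl rfl)
  have hkeep : ∀ q, a.foldl (shortcutStep Fail g) f q = g q →
      shortcutFinal Fail f g (a ++ p :: b) q = g q := by
    intro q h
    have := foldl_keep Fail g q (p :: b) _ h
    simpa [shortcutFinal] using this
  refine ⟨Function.update (a.foldl (shortcutStep Fail g) f) p (g p), ?_, by simp, ?_, ?_⟩
  · intro hF
    have h1 : shortcutFinal Fail f g (a ++ p :: b) p = g p := by
      rw [hfin]
      apply foldl_keep
      simp [shortcutStep, hF]
    exact hdisj p (Eq.trans (Eq.symm hp) h1)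
  · intro q hq hne
    rw [Function.update_of_ne hne]
    rcases hfg q with h | h
    · exact h
    · exact absurd (Eq.trans (Eq.symm hq) (hkeep q h)) (hdisj q)
  · intro q
    by_cases e : q = p
    · subst e; simp
    · rw [Function.update_of_ne e]; exact hfg q
end
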